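/- For convex functions φ, ψ : ℝⁿ → ℝ, the set of subgradients of their sum is contained in the Minkowski sum of their sets of subgradients: Δ_{φ+ψ} ⊆ Δ_φ + Δ_ψ, i.e. every y ∈ ℝⁿ such that x ↦ φ(x) + ψ(x) − ⟨x,y⟩ is bounded below can be written as y = y₁ + y₂ where x ↦ φ(x) − ⟨x,y₁⟩ and x ↦ ψ(x) − ⟨x,y₂⟩ are both bounded below. -/

import Mathlib

open scoped RealInnerProductSpace Pointwise

/-- The set of subgradients of a function `χ : ℝⁿ → ℝ`: those `y` such that
`x ↦ χ(x) − ⟨x,y⟩` is bounded below. -/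
def subgradSet {n : ℕ} (χ : EuclideanSpace ℝ (Fin n) → ℝ) : Set (EuclideanSpace ℝ (Fin n)) :=
  {y | BddBelow (Set.range fun x => χ x - ⟪x, y⟫)}

/-- for convex φ, ψ : ℝⁿ → ℝ one has Δ_{φ+ψ} ⊆ Δ_φ + Δ_ψ (Minkowski sum). -/
theorem subgradSet_add_subset {n : ℕ}
    (φ ψ : EuclideanSpace ℝ (Fin n) → ℝ)
    (hφ : ConvexOn ℝ Set.univ φ) (hψ : ConvexOn ℝ Set.univ ψ) :
    subgradSet (fun x => φ x + ψ x) ⊆ subgradSet φ + subgradSet ψ := by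
  rintro y ⟨m, hm⟩
  replace hm : ∀ x, m ≤ φ x + ψ x - ⟪x, y⟫ := fun x => hm ⟨x, rfl⟩
  have hcont : Continuous φ := by
    simpa [continuousOn_univ] using hφ.continuousOn isOpen_univ
  have hopen : IsOpen {p : EuclideanSpace ℝ (Fin n) × ℝ | p.1 ∈ Set.univ ∧ φ p.1 < p.2} := by
    simpa using isOpen_lt (hcont.comp continuous_fst) continuous_snd
  have hconc : Convex ℝ
      {p : EuclideanSpace ℝ (Fin n) × ℝ | p.2 ≤ m + ⟪p.1, y⟫ - ψ p.1} := by
    rintro ⟨x, r⟩ hr ⟨z, s⟩ hs a b ha hb hab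
    have hψxz := hψ.2 (Set.mem_univ x) (Set.mem_univ z) ha hb hab
    simp only [Set.mem_ofPred_eq, Prod.smul_mk, Prod.mk_add_mk, smul_eq_mul, inner_add_left,
      real_inner_smul_left] at hr hs hψxz ⊢
    have hma : a * m + b * m = m := by rw [← add_mul, hab, one_mul]
    linarith [mul_le_mul_of_nonneg_left hr ha, mul_le_mul_of_nonneg_left hs hb]
  have hdisj : Disjoint {p : EuclideanSpace ℝ (Fin n) × ℝ | p.1 ∈ Set.univ ∧ φ p.1 < p.2}
      {p : EuclideanSpace ℝ (Fin n) × ℝ | p.2 ≤ m + ⟪p.1, y⟫ - ψ p.1} := by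
    rw [Set.disjoint_left]
    rintro ⟨x, r⟩ ⟨-, h⟩ h'
    simp only [Set.mem_ofPred_eq] at h h'
    linarith [hm x]
  obtain ⟨f, u, hfu, huf⟩ :=
    geometric_hahn_banach_open hφ.convex_strict_epigraph hopen hconc hdisj
  have hsplit : ∀ x r, f (x, r) = f (x, 0) + r * f (0, 1) := fun x r => by
    rw [← smul_eq_mul, ← map_smul, ← map_add]
    simp
  have hlt : ∀ x r, φ x < r → f (x, 0) + r * f (0, 1) < u := fun x r h => by
    rw [← hsplit]
    exact hfu _ ⟨Set.mem_univ x, h⟩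
  have hle : ∀ x, u ≤ f (x, 0) + (m + ⟪x, y⟫ - ψ x) * f (0, 1) := fun x => by
    rw [← hsplit]
    exact huf _ (by simp)
  have hc : f (0, 1) < 0 := by
    have h₁ := hlt 0 (φ 0 + 1) (by linarith)
    have h₂ := hle 0
    have h₃ := hm 0
    by_contra! hc
    nlinarith
  have hφle : ∀ x, f (x, 0) + φ x * f (0, 1) ≤ u := fun x => by
    by_contra! h
    have h₁ := hlt x (φ x + (u - f (x, 0) - φ x * f (0, 1)) / f (0, 1))
      (lt_add_of_pos_right _ (div_pos_of_neg_of_neg (by linarith) hc))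
    rw [add_mul, div_mul_cancel₀ _ hc.ne] at h₁
    linarith
  set c := f (0, 1)
  let w := (InnerProductSpace.toDual ℝ (EuclideanSpace ℝ (Fin n))).symm
    ((-c⁻¹) • f.comp (ContinuousLinearMap.inl ℝ _ ℝ))
  have hw : ∀ x, ⟪x, w⟫ * c = -f (x, 0) := fun x => by
    rw [real_inner_comm, InnerProductSpace.toDual_symm_apply]
    simp
    field_simp [hc.ne]
  refine ⟨w, ⟨u / c, ?_⟩, y - w, ⟨m - u / c, ?_⟩, add_sub_cancel _ _⟩
  · rintro _ ⟨x, rfl⟩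
    rw [div_le_iff_of_neg hc]
    linarith [hφle x, hw x]
  · rintro _ ⟨x, rfl⟩
    have h : m - (ψ x - ⟪x, y - w⟫) ≤ u / c := by
      rw [le_div_iff_of_neg hc, inner_sub_right]
      linarith [hle x, hw x]
    dsimp only
    linarith
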